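/- arXiv:1811.12702 — 3 statements merged into one kernel-verified Lean document; each statement's English description precedes it below -/
import Mathlib

section
/- Assume hypothesis (H0), let W be a p₀-Minimum Restraint Function with p₀ ≥ 0, and let K be a W-feedback. Then for every pair 0 < μ̂ < σ there exists δ̄ = δ̄(μ̂,σ) > 0 such that: for every partition π of [0,∞) with diam(π) ≤ δ̄ and every initial point z ∈ ℝⁿ ∖ C with W(z) ∈ (μ̂, σ], any π-sampling trajectory x of ẋ = f(x,u) from z associated with K (extended continuously to [0,∞) if its exit time is finite) is defined on all of [0,∞), the time t̄ := inf{t ≥ 0 : W(x(t)) ≤ μ̂/4} is finite, and x(t) ∈ W⁻¹([0,μ̂]) for all t ≥ t̄. -/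
open Filter Topology Metric MeasureTheory Bornology
open scoped RealInnerProductSpace ENNReal NNReal

noncomputable section

abbrev Euc (n : ℕ) : Type := EuclideanSpace ℝ (Fin n)

/-- Distance to the target set. -/
def dC {n : ℕ} (C : Set (Euc n)) (y : Euc n) : ℝ := Metric.infDist y C

/-- The Hamiltonian `H(x, p₀, p) = inf_{u ∈ U} (⟪p, f(x,u)⟫ + p₀ l(x,u))`. -/
def Ham {n m : ℕ} (U : Set (Euc m)) (f : Euc n → Euc m → Euc n) (l : Euc n → Euc m → ℝ)
    (p0 : ℝ) (x p : Euc n) : ℝ :=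
  sInf ((fun u => ⟪p, f x u⟫ + p0 * l x u) '' U)

/-- The Hamiltonian truncated to controls of norm at most `N`. -/
def HamN {n m : ℕ} (U : Set (Euc m)) (f : Euc n → Euc m → Euc n) (l : Euc n → Euc m → ℝ)
    (N : ℝ) (p0 : ℝ) (x p : Euc n) : ℝ :=
  sInf ((fun u => ⟪p, f x u⟫ + p0 * l x u) '' (U ∩ Metric.closedBall 0 N))

/-- Set of limiting gradients `D*W(x)`. -/
def limitingGradients {n : ℕ} (W : Euc n → ℝ) (x : Euc n) : Set (Euc n) :=
  {w | ∃ xk : ℕ → Euc n, (∀ k, DifferentiableAt ℝ W (xk k) ∧ xk k ≠ x) ∧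
    Tendsto xk atTop (𝓝 x) ∧ Tendsto (fun k => gradient W (xk k)) atTop (𝓝 w)}

/-- Proximal subdifferential `∂_P W(x)`. -/
def proxSubdiff {n : ℕ} (W : Euc n → ℝ) (x : Euc n) : Set (Euc n) :=
  {p | ∃ σ > (0:ℝ), ∃ η > (0:ℝ), ∀ y, ‖y - x‖ ≤ η →
    ⟪p, y - x⟫ ≤ W y - W x + σ * ‖y - x‖ ^ 2}

/-- Limiting subdifferential `∂_L W(x)`. -/
def limitingSubdiff {n : ℕ} (W : Euc n → ℝ) (x : Euc n) : Set (Euc n) :=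
  {p | ∃ (xk : ℕ → Euc n) (pk : ℕ → Euc n), (∀ k, pk k ∈ proxSubdiff W (xk k)) ∧
    Tendsto xk atTop (𝓝 x) ∧ Tendsto pk atTop (𝓝 p)}

/-- `W` is positive definite on `ℝⁿ ∖ C`. -/
def PosDefOn {n : ℕ} (C : Set (Euc n)) (W : Euc n → ℝ) : Prop :=
  (∀ x, x ∉ C → 0 < W x) ∧ ∀ x ∈ frontier C, W x = 0

/-- `W` is proper on `ℝⁿ ∖ C`: preimages (within the closure of the complement of the
target) of compact subsets of `[0,∞)` are compact. -/
def ProperOn {n : ℕ} (C : Set (Euc n)) (W : Euc n → ℝ) : Prop :=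
  ∀ Kc : Set ℝ, IsCompact Kc → Kc ⊆ Set.Ici 0 → IsCompact (closure Cᶜ ∩ W ⁻¹' Kc)

/-- `W` is locally semiconcave on `ℝⁿ ∖ C`. -/
def LocSemiconcaveOn {n : ℕ} (C : Set (Euc n)) (W : Euc n → ℝ) : Prop :=
  ∀ S : Set (Euc n), IsCompact S → S ⊆ Cᶜ → ∃ ρ > (0:ℝ),
    ∀ x y : Euc n, segment ℝ x y ⊆ S →
      W x + W y - 2 * W (midpoint ℝ x y) ≤ ρ * ‖x - y‖ ^ 2

/-- `W` is locally Lipschitz continuous on the set `s`. -/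
def LocLipschitzOn {n : ℕ} (s : Set (Euc n)) (W : Euc n → ℝ) : Prop :=
  ∀ x ∈ s, ∃ (K : ℝ≥0) (t : Set (Euc n)), t ∈ nhdsWithin x s ∧ LipschitzOnWith K W t

/-- `γ : (0,∞) → (0,∞)` is a continuous, strictly increasing rate function. -/
def RateFun (γ : ℝ → ℝ) : Prop :=
  ContinuousOn γ (Set.Ioi 0) ∧ StrictMonoOn γ (Set.Ioi 0) ∧ ∀ r, 0 < r → 0 < γ r

/-- `W` is a `p₀`-Minimum Restraint Function with rate `γ`. -/
def IsMRF {n m : ℕ} (C : Set (Euc n)) (U : Set (Euc m)) (f : Euc n → Euc m → Euc n)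
    (l : Euc n → Euc m → ℝ) (p0 : ℝ) (W : Euc n → ℝ) (γ : ℝ → ℝ) : Prop :=
  ContinuousOn W (closure Cᶜ) ∧ (∀ x ∈ closure Cᶜ, 0 ≤ W x) ∧
  LocSemiconcaveOn C W ∧ PosDefOn C W ∧ ProperOn C W ∧ RateFun γ ∧
  ∀ x, x ∉ C → ∀ p ∈ limitingGradients W x, Ham U f l p0 x p ≤ -γ (W x)

/-- `W` is a `p₀`-OMRF (original Minimum Restraint Function of Motta-Rampazzo). -/
def IsOMRF {n m : ℕ} (C : Set (Euc n)) (U : Set (Euc m)) (f : Euc n → Euc m → Euc n)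
    (l : Euc n → Euc m → ℝ) (p0 : ℝ) (W : Euc n → ℝ) : Prop :=
  ContinuousOn W (closure Cᶜ) ∧ (∀ x ∈ closure Cᶜ, 0 ≤ W x) ∧
  LocSemiconcaveOn C W ∧ PosDefOn C W ∧ ProperOn C W ∧
  ∀ x, x ∉ C → ∀ p ∈ limitingGradients W x, Ham U f l p0 x p < 0

/-- Hypothesis (H0). -/
def HypH0 {n m : ℕ} (C : Set (Euc n)) (U : Set (Euc m)) (f : Euc n → Euc m → Euc n)
    (l : Euc n → Euc m → ℝ) : Prop :=
  IsClosed C ∧ IsCompact (frontier C) ∧ IsClosed U ∧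
  (∀ x u, u ∈ U → 0 ≤ l x u) ∧
  (∀ Kc : Set (Euc n), IsCompact Kc → Kc ⊆ Cᶜ →
    UniformContinuousOn (fun q : Euc n × Euc m => f q.1 q.2) (Kc ×ˢ U) ∧
    UniformContinuousOn (fun q : Euc n × Euc m => l q.1 q.2) (Kc ×ˢ U)) ∧
  (∀ R : ℝ, 0 < R → ∃ M : ℝ, 0 < M ∧ ∀ x u, dC C x ≤ R → x ∉ C → u ∈ U →
    ‖f x u‖ ≤ M ∧ l x u ≤ M)

/-- Hypothesis (H1). -/
def HypH1 {n m : ℕ} (C : Set (Euc n)) (U : Set (Euc m)) (f : Euc n → Euc m → Euc n)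
    (l : Euc n → Euc m → ℝ) : Prop :=
  IsClosed C ∧ IsCompact (frontier C) ∧ IsClosed U ∧
  (∀ x u, u ∈ U → 0 ≤ l x u) ∧
  ContinuousOn (fun q : Euc n × Euc m => f q.1 q.2) (closure Cᶜ ×ˢ U) ∧
  ContinuousOn (fun q : Euc n × Euc m => l q.1 q.2) (closure Cᶜ ×ˢ U) ∧
  (∀ Kc : Set (Euc n), IsCompact Kc → Kc ⊆ closure Cᶜ →
    ∃ Mf Ml Lf Ll : ℝ, 0 < Mf ∧ 0 < Ml ∧ 0 < Lf ∧ 0 < Ll ∧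
      (∀ x ∈ Kc, ∀ u ∈ U, ‖f x u‖ ≤ Mf ∧ l x u ≤ Ml) ∧
      (∀ x₁ ∈ Kc, ∀ x₂ ∈ Kc, ∀ u ∈ U,
        ‖f x₁ u - f x₂ u‖ ≤ Lf * ‖x₁ - x₂‖ ∧ |l x₁ u - l x₂ u| ≤ Ll * ‖x₁ - x₂‖))

/-- A partition of `[0,∞)`. -/
structure TimePartition where
  t : ℕ → ℝ
  zero : t 0 = 0
  mono : StrictMono t
  unbounded : Tendsto t atTop atTop

/-- A class-`KL` comparison function. -/
structure IsKL (β : ℝ → ℝ → ℝ) : Prop where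
  nonneg : ∀ r t, 0 ≤ r → 0 ≤ t → 0 ≤ β r t
  cont : ∀ t, 0 ≤ t → ContinuousOn (fun r => β r t) (Set.Ici 0)
  strictMono : ∀ t, 0 ≤ t → StrictMonoOn (fun r => β r t) (Set.Ici 0)
  zero : ∀ t, 0 ≤ t → β 0 t = 0
  anti : ∀ r, 0 ≤ r → AntitoneOn (fun t => β r t) (Set.Ici 0)
  tendsto : ∀ r, 0 ≤ r → Tendsto (fun t => β r t) atTop (𝓝 0)

/-- `(x,u)` is a `π`-sampling trajectory-control pair from `z` associated with the
feedback `K`, with exit time `T`; trajectories reaching the target at a finite exit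
time are extended to `[0,∞)` by their limit value. -/
structure IsSamplingSol {n m : ℕ} (C : Set (Euc n)) (U : Set (Euc m))
    (f : Euc n → Euc m → Euc n) (K : Euc n → Euc m) (π : TimePartition) (z : Euc n)
    (x : ℝ → Euc n) (u : ℝ → Euc m) (T : ℝ≥0∞) : Prop where
  pos : 0 < T
  init : x 0 = z
  cont : ContinuousOn x (Set.Ici 0)
  ctrl : ∀ j : ℕ, ∀ t ∈ Set.Ico (π.t j) (π.t (j+1)), u t = K (x (π.t j))
  outside : ∀ t : ℝ, 0 ≤ t → ENNReal.ofReal t < T → x t ∉ C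
  deriv : ∀ t : ℝ, 0 < t → ENNReal.ofReal t < T → (∀ j, t ≠ π.t j) →
    HasDerivAt x (f (x t) (u t)) t
  exit : ∀ tr : ℝ, 0 ≤ tr → T = ENNReal.ofReal tr →
    dC C (x tr) = 0 ∧ ∀ s, tr ≤ s → x s = x tr

/-- The time `T̄ᵣ` after which the trajectory remains in the `r`-neighbourhood
of the target. -/
def Tbar {n : ℕ} (C : Set (Euc n)) (x : ℝ → Euc n) (r : ℝ) : ℝ :=
  sInf {t : ℝ | 0 < t ∧ ∀ τ, t ≤ τ → dC C (x τ) ≤ r}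

/-- `K` sample stabilizes the system to `C` with `(q,W)`-regulated cost, for initial
points in `Z`. -/
def SampleStabOn {n m : ℕ} (C : Set (Euc n)) (U : Set (Euc m))
    (f : Euc n → Euc m → Euc n) (l : Euc n → Euc m → ℝ) (K : Euc n → Euc m)
    (Z : Set (Euc n)) (q : ℝ) (W : Euc n → ℝ) : Prop :=
  ∃ β : ℝ → ℝ → ℝ, IsKL β ∧
    ∀ r R : ℝ, 0 < r → r < R → ∃ δ > (0:ℝ),
      ∀ π : TimePartition, (∀ j, π.t (j+1) - π.t j ≤ δ) →
      ∀ z ∈ Z, dC C z ≤ R →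
      ∀ x u T, IsSamplingSol C U f K π z x u T →
        (∀ t, 0 ≤ t → dC C (x t) ≤ max (β R t) r) ∧
        (∫ τ in (0:ℝ)..(Tbar C x r), l (x τ) (u τ)) ≤ W z / q

/-- `X` is an Euler trajectory of the system from `z` associated with `K`. -/
def IsEulerTraj {n m : ℕ} (C : Set (Euc n)) (U : Set (Euc m))
    (f : Euc n → Euc m → Euc n) (K : Euc n → Euc m) (z : Euc n) (X : ℝ → Euc n) : Prop :=
  ∃ (π : ℕ → TimePartition) (x : ℕ → ℝ → Euc n) (u : ℕ → ℝ → Euc m)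
    (T : ℕ → ℝ≥0∞) (δ : ℕ → ℝ),
    Tendsto δ atTop (𝓝 0) ∧ (∀ i j, (π i).t (j+1) - (π i).t j ≤ δ i) ∧
    (∀ i, IsSamplingSol C U f K (π i) z (x i) (u i) (T i)) ∧
    TendstoLocallyUniformlyOn x X atTop (Set.Ici 0)

/-- `(X, X⁰)` is an Euler trajectory-cost pair from `z` associated with `K`. -/
def IsEulerPair {n m : ℕ} (C : Set (Euc n)) (U : Set (Euc m))
    (f : Euc n → Euc m → Euc n) (l : Euc n → Euc m → ℝ) (K : Euc n → Euc m)
    (z : Euc n) (X : ℝ → Euc n) (X0 : ℝ → ℝ) : Prop :=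
  ∃ (π : ℕ → TimePartition) (x : ℕ → ℝ → Euc n) (u : ℕ → ℝ → Euc m)
    (T : ℕ → ℝ≥0∞) (δ : ℕ → ℝ),
    Tendsto δ atTop (𝓝 0) ∧ (∀ i j, (π i).t (j+1) - (π i).t j ≤ δ i) ∧
    (∀ i, IsSamplingSol C U f K (π i) z (x i) (u i) (T i)) ∧
    TendstoLocallyUniformlyOn x X atTop (Set.Ici 0) ∧
    TendstoLocallyUniformlyOn (fun i s => ∫ τ in (0:ℝ)..s, l (x i τ) (u i τ)) X0
      atTop (Set.Ici 0)

/-- The filter of approach to `T` from the left (`atTop` when `T = ∞`). -/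
def leftFilter (T : ℝ≥0∞) : Filter ℝ :=
  if T = ⊤ then Filter.atTop else nhdsWithin T.toReal (Set.Iio T.toReal)

/-- The exit time `T_X` of a (Euler) trajectory `X`. -/
def exitTimeInf {n : ℕ} (C : Set (Euc n)) (X : ℝ → Euc n) : ℝ≥0∞ :=
  sInf {τ : ℝ≥0∞ | 0 < τ ∧ (∀ t : ℝ, 0 ≤ t → ENNReal.ofReal t < τ → X t ∉ C) ∧
    Tendsto (fun t => dC C (X t)) (leftFilter τ) (𝓝 0)}

/-- `K` Euler stabilizes the system to `C` with `(q,W)`-regulated cost, for initial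
points in `Z`. -/
def EulerStabOn {n m : ℕ} (C : Set (Euc n)) (U : Set (Euc m))
    (f : Euc n → Euc m → Euc n) (l : Euc n → Euc m → ℝ) (K : Euc n → Euc m)
    (Z : Set (Euc n)) (q : ℝ) (W : Euc n → ℝ) : Prop :=
  ∃ β : ℝ → ℝ → ℝ, IsKL β ∧
    ∀ z ∈ Z,
      (∀ X, IsEulerTraj C U f K z X → ∀ t, 0 ≤ t → dC C (X t) ≤ β (dC C z) t) ∧
      (∀ X X0, IsEulerPair C U f l K z X X0 →
        ∀ t, 0 ≤ t → ENNReal.ofReal t < exitTimeInf C X → X0 t ≤ W z / q)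

/-- A locally bounded feedback taking values in the control set. -/
def IsFeedback {n m : ℕ} (C : Set (Euc n)) (U : Set (Euc m)) (K : Euc n → Euc m) : Prop :=
  (∀ x, x ∉ C → K x ∈ U) ∧
  ∀ x, x ∉ C → ∃ V ∈ 𝓝 x, Bornology.IsBounded (K '' (V \ C))

/-- `K` is a `W`-feedback: for the selection `psel x ∈ D*W(x)`, `K x` minimizes
`u ↦ ⟪psel x, f(x,u)⟫ + p₀ l(x,u)` over `U ∩ B(0, N(W x))`. -/
def IsWFeedback {n m : ℕ} (C : Set (Euc n)) (U : Set (Euc m))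
    (f : Euc n → Euc m → Euc n) (l : Euc n → Euc m → ℝ) (p0 : ℝ) (W : Euc n → ℝ)
    (N : ℝ → ℝ) (psel : Euc n → Euc n) (K : Euc n → Euc m) : Prop :=
  ∀ x, x ∉ C →
    K x ∈ U ∩ Metric.closedBall 0 (N (W x)) ∧
    ∀ v ∈ U ∩ Metric.closedBall 0 (N (W x)),
      ⟪psel x, f x (K x)⟫ + p0 * l x (K x) ≤ ⟪psel x, f x v⟫ + p0 * l x v

/-- `(x,u)` is an admissible trajectory-control pair from `z` with exit time `T`. -/
structure IsAdmissiblePair {n m : ℕ} (C : Set (Euc n)) (U : Set (Euc m))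
    (f : Euc n → Euc m → Euc n) (z : Euc n) (x : ℝ → Euc n) (u : ℝ → Euc m)
    (T : ℝ≥0∞) : Prop where
  pos : 0 < T
  init : x 0 = z
  outside : ∀ t : ℝ, 0 ≤ t → ENNReal.ofReal t < T → x t ∉ C
  ctrlmem : ∀ t : ℝ, 0 ≤ t → ENNReal.ofReal t < T → u t ∈ U
  meas : AEStronglyMeasurable u volume
  locbdd : ∀ b : ℝ, 0 ≤ b → ENNReal.ofReal b < T →
    ∃ M : ℝ, ∀ᵐ s ∂volume, s ∈ Set.Icc (0:ℝ) b → ‖u s‖ ≤ M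
  sol : ∀ t : ℝ, 0 ≤ t → ENNReal.ofReal t < T →
    x t = z + ∫ s in (0:ℝ)..t, f (x s) (u s)

end

section Helpers

theorem first_hit {φ : ℝ → ℝ} {a b v : ℝ} (hab : a ≤ b) (hc : ContinuousOn φ (Set.Icc a b))
    (ha : φ a < v) (hb : v ≤ φ b) :
    ∃ t, a < t ∧ t ≤ b ∧ φ t = v ∧ ∀ s, a ≤ s → s < t → φ s < v := by
  have hcl : IsClosed (Set.Icc a b ∩ φ ⁻¹' Set.Ici v) :=
    hc.preimage_isClosed_of_isClosed isClosed_Icc isClosed_Ici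
  have hcomp : IsCompact (Set.Icc a b ∩ φ ⁻¹' Set.Ici v) :=
    isCompact_Icc.of_isClosed_subset hcl Set.inter_subset_left
  obtain ⟨t, ht, hmin⟩ := hcomp.exists_isLeast ⟨b, ⟨hab, le_refl b⟩, hb⟩
  have htv : v ≤ φ t := ht.2
  have hlt : ∀ s, a ≤ s → s < t → φ s < v := by
    intro s hs hst
    by_contra hcon
    have := hmin ⟨⟨hs, hst.le.trans ht.1.2⟩, not_lt.1 hcon⟩
    linarith
  refine ⟨t, lt_of_le_of_ne ht.1.1 ?_, ht.1.2, ?_, hlt⟩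
  · rintro rfl
    linarith
  · obtain ⟨s, hs, hsv⟩ := intermediate_value_Icc ht.1.1
      (hc.mono (Set.Icc_subset_Icc_right ht.1.2)) (Set.mem_Icc.2 ⟨ha.le, htv⟩)
    rcases hs.2.eq_or_lt with h | h
    · rw [← h]; exact hsv
    · have := hlt s hs.1 h
      linarith

theorem semiconc_diff {n : ℕ} {W : Euc n → ℝ} {S : Set (Euc n)} {ρ : ℝ} (hρ : 0 < ρ)
    (hS : ∀ x y : Euc n, segment ℝ x y ⊆ S →
      W x + W y - 2 * W (midpoint ℝ x y) ≤ ρ * ‖x - y‖ ^ 2)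
    {a y : Euc n} (hseg : segment ℝ a y ⊆ S) (hd : DifferentiableAt ℝ W a) :
    W y ≤ W a + ⟪gradient W a, y - a⟫ + 2 * ρ * ‖y - a‖ ^ 2 := by
  set D := ‖y - a‖ with hD
  set g : ℝ → ℝ := fun s => W (a + s • (y - a)) with hg
  have hg0 : g 0 = W a := by simp [hg]
  have hg1 : g 1 = W y := by simp [hg]
  have hmem : ∀ s : ℝ, 0 ≤ s → s ≤ 1 → a + s • (y - a) ∈ segment ℝ a y := by
    intro s h0 h1
    rw [segment_eq_image']
    exact ⟨s, ⟨h0, h1⟩, rfl⟩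
  have hstep : ∀ s : ℝ, 0 ≤ s → s ≤ 1 → g s + g 0 - 2 * g (s / 2) ≤ ρ * (s ^ 2 * D ^ 2) := by
    intro s h0 h1
    have h := hS (a + s • (y - a)) a ?_
    · have hm : midpoint ℝ (a + s • (y - a)) a = a + (s / 2) • (y - a) := by
        rw [midpoint_eq_smul_add]
        simp only [invOf_eq_inv]
        module
      rw [hm] at h
      have e : ‖a + s • (y - a) - a‖ ^ 2 = s ^ 2 * D ^ 2 := by
        rw [add_sub_cancel_left, norm_smul, mul_pow, Real.norm_eq_abs, sq_abs]
      rw [e] at h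
      rw [hg0]
      exact h
    · refine ((convex_segment a y).segment_subset (hmem s h0 h1) (left_mem_segment ℝ a y)).trans hseg
  have hq : ∀ k : ℕ, g 1 - g 0 ≤ (2:ℝ) ^ k * (g ((1/2:ℝ)^k) - g 0)
      + 2 * ρ * D ^ 2 * (1 - (1/2:ℝ)^k) := by
    intro k
    induction k with
    | zero => simp
    | succ k ih =>
      have hp : (0:ℝ) < (1/2:ℝ)^k := by positivity
      have h1 : (1/2:ℝ)^k ≤ 1 := pow_le_one₀ (by norm_num) (by norm_num)
      have h := hstep ((1/2:ℝ)^k) hp.le h1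
      have e2 : (2:ℝ)^k * (1/2:ℝ)^k = 1 := by rw [← mul_pow]; norm_num
      have e3 : (1/2:ℝ)^(k+1) = (1/2:ℝ)^k / 2 := by rw [pow_succ]; ring
      rw [e3, pow_succ]
      set r := (1/2:ℝ)^k
      have h2 : (0:ℝ) < 2 ^ k := by positivity
      have h3 := mul_le_mul_of_nonneg_left h h2.le
      have e4 : (2:ℝ)^k * (ρ * (r ^ 2 * D ^ 2)) = ρ * r * D ^ 2 := by
        calc _ = ρ * ((2:ℝ)^k * r) * r * D ^ 2 := by ring
          _ = _ := by rw [e2]; ring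
      rw [e4] at h3
      linarith
  have hgr : HasDerivAt g ⟪gradient W a, y - a⟫ 0 := by
    have h1 : HasFDerivAt W (fderiv ℝ W a) (a + (0:ℝ) • (y - a)) := by
      simpa using hd.hasFDerivAt
    have h2 : HasDerivAt (fun s : ℝ => a + s • (y - a)) (y - a) 0 := by
      simpa using ((hasDerivAt_id (0:ℝ)).smul_const (y - a)).const_add a
    have h3 := h1.comp_hasDerivAt (0:ℝ) h2
    have e : ⟪gradient W a, y - a⟫ = fderiv ℝ W a (y - a) := by
      simp [gradient]
    rw [e]
    exact h3
  have hlim : Tendsto (fun k : ℕ => (2:ℝ) ^ k * (g ((1/2:ℝ)^k) - g 0)) atTop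
      (𝓝 ⟪gradient W a, y - a⟫) := by
    have h := hgr.tendsto_slope_zero
    have hk : Tendsto (fun k : ℕ => (1/2:ℝ)^k) atTop (𝓝[≠] 0) := by
      rw [tendsto_nhdsWithin_iff]
      refine ⟨tendsto_pow_atTop_nhds_zero_of_lt_one (by norm_num) (by norm_num), ?_⟩
      filter_upwards with k
      exact (show (0:ℝ) < (1/2:ℝ)^k by positivity).ne'
    refine (h.comp hk).congr ?_
    intro k
    simp
  have hge : g 1 - g 0 - 2 * ρ * D ^ 2 ≤ ⟪gradient W a, y - a⟫ := by
    refine ge_of_tendsto' hlim ?_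
    intro k
    have := hq k
    have hp : (0:ℝ) ≤ 2 * ρ * D ^ 2 * (1/2:ℝ)^k := by positivity
    linarith
  rw [hg0, hg1] at hge
  linarith

theorem semiconc_lim {n : ℕ} {C : Set (Euc n)} {W : Euc n → ℝ} {S : Set (Euc n)} {ρ : ℝ}
    (hρ : 0 < ρ) (hCl : IsClosed C) (hWc : ContinuousOn W (closure Cᶜ)) (hSC : S ⊆ Cᶜ)
    (hS : ∀ x y : Euc n, segment ℝ x y ⊆ S →
      W x + W y - 2 * W (midpoint ℝ x y) ≤ ρ * ‖x - y‖ ^ 2)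
    {x y p : Euc n} {η : ℝ} (hball : ball x η ⊆ S) (hy : y ∈ ball x η)
    (hp : p ∈ limitingGradients W x) :
    W y ≤ W x + ⟪p, y - x⟫ + 2 * ρ * ‖y - x‖ ^ 2 := by
  obtain ⟨xk, hxk, hlim, hg⟩ := hp
  have hη : 0 < η := pos_of_mem_ball hy
  have hxC : x ∈ Cᶜ := hSC (hball (mem_ball_self hη))
  have hWx : ContinuousAt W x :=
    hWc.continuousAt (mem_of_superset (hCl.isOpen_compl.mem_nhds hxC) subset_closure)
  have h1 : Tendsto (fun k => W (xk k) + ⟪gradient W (xk k), y - xk k⟫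
      + 2 * ρ * ‖y - xk k‖ ^ 2) atTop (𝓝 (W x + ⟪p, y - x⟫ + 2 * ρ * ‖y - x‖ ^ 2)) := by
    have hyx : Tendsto (fun k => y - xk k) atTop (𝓝 (y - x)) := tendsto_const_nhds.sub hlim
    exact ((hWx.tendsto.comp hlim).add (hg.inner hyx)).add ((hyx.norm.pow 2).const_mul _)
  refine ge_of_tendsto h1 ?_
  filter_upwards [hlim (ball_mem_nhds x hη)] with k hk
  exact semiconc_diff hρ hS (((convex_ball x η).segment_subset hk hy).trans hball) (hxk k).1

theorem partition_locate (π : TimePartition) {t : ℝ} (ht : 0 ≤ t) :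
    ∃ j, π.t j ≤ t ∧ t < π.t (j+1) := by
  have hex : ∃ j, t < π.t j := (π.unbounded.eventually_gt_atTop t).exists
  classical
  have h0 : Nat.find hex ≠ 0 := by
    intro h
    have := Nat.find_spec hex
    rw [h, π.zero] at this
    linarith
  obtain ⟨j, hj⟩ := Nat.exists_eq_succ_of_ne_zero h0
  refine ⟨j, ?_, ?_⟩
  · have := Nat.find_min hex (m := j) (by omega)
    exact not_lt.1 this
  · have := Nat.find_spec hex
    rw [hj] at this
    exact this

theorem partition_nonneg (π : TimePartition) (j : ℕ) : 0 ≤ π.t j := by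
  rw [← π.zero]; exact π.mono.monotone (Nat.zero_le j)

theorem sol_mvt {n m : ℕ} {C : Set (Euc n)} {U : Set (Euc m)}
    {f : Euc n → Euc m → Euc n} {K : Euc n → Euc m} {π : TimePartition} {z : Euc n}
    {x : ℝ → Euc n} {u : ℝ → Euc m} {T : ℝ≥0∞} (h : IsSamplingSol C U f K π z x u T)
    {j : ℕ} {a b : ℝ} (ha : π.t j ≤ a) (hab : a < b) (hb : b ≤ π.t (j+1))
    (hT : ∀ s, a < s → s < b → ENNReal.ofReal s < T) (v : Euc n) :
    ∃ s, a < s ∧ s < b ∧ ⟪v, x b - x a⟫ = (b - a) * ⟪v, f (x s) (K (x (π.t j)))⟫ := by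
  have h0 := partition_nonneg π j
  have hder : ∀ s ∈ Set.Ioo a b, HasDerivAt (fun s => ⟪v, x s⟫)
      ⟪v, f (x s) (K (x (π.t j)))⟫ s := by
    intro s hs
    have hd := h.deriv s (by linarith [hs.1]) (hT s hs.1 hs.2) ?_
    · rw [h.ctrl j s ⟨by linarith [hs.1], by linarith [hs.2]⟩] at hd
      simpa using (hasDerivAt_const s v).inner ℝ hd
    · rintro i rfl
      have h1 : j < i := π.mono.lt_iff_lt.1 (lt_of_le_of_lt ha hs.1)
      have h2 : i < j + 1 := π.mono.lt_iff_lt.1 (lt_of_lt_of_le hs.2 hb)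
      omega
  have hcont : ContinuousOn (fun s => ⟪v, x s⟫) (Set.Icc a b) :=
    continuousOn_const.inner (h.cont.mono fun s hs => (by
      have := hs.1
      simp only [Set.mem_Ici]; linarith))
  obtain ⟨s, hs, he⟩ := exists_hasDerivAt_eq_slope _ _ hab hcont hder
  refine ⟨s, hs.1, hs.2, ?_⟩
  have hne : b - a ≠ 0 := by linarith
  rw [he, inner_sub_right]
  field_simp

theorem sol_norm {n m : ℕ} {C : Set (Euc n)} {U : Set (Euc m)}
    {f : Euc n → Euc m → Euc n} {K : Euc n → Euc m} {π : TimePartition} {z : Euc n}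
    {x : ℝ → Euc n} {u : ℝ → Euc m} {T : ℝ≥0∞} (h : IsSamplingSol C U f K π z x u T)
    {j : ℕ} {a b M : ℝ} (ha : π.t j ≤ a) (hab : a < b) (hb : b ≤ π.t (j+1))
    (hT : ∀ s, a < s → s < b → ENNReal.ofReal s < T)
    (hM : ∀ s, a < s → s < b → ‖f (x s) (K (x (π.t j)))‖ ≤ M) :
    ‖x b - x a‖ ≤ M * (b - a) := by
  obtain ⟨s, h1, h2, he⟩ := sol_mvt h ha hab hb hT (x b - x a)
  have h3 := real_inner_le_norm (x b - x a) (f (x s) (K (x (π.t j))))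
  rw [real_inner_self_eq_norm_sq] at he
  have h4 := hM s h1 h2
  rcases (norm_nonneg (x b - x a)).eq_or_lt with h0 | h0
  · rw [← h0]
    have : 0 ≤ M := (norm_nonneg _).trans h4
    exact mul_nonneg this (by linarith)
  · have h5 : ‖x b - x a‖ * ‖f (x s) (K (x (π.t j)))‖ ≤ ‖x b - x a‖ * M :=
      mul_le_mul_of_nonneg_left h4 h0.le
    have h6 : ‖x b - x a‖ ^ 2 ≤ (b - a) * (‖x b - x a‖ * M) := by
      rw [he]
      exact mul_le_mul_of_nonneg_left (h3.trans h5) (by linarith)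
    refine le_of_mul_le_mul_left ?_ h0
    nlinarith

end Helpers

section Helpers2

theorem sol_lt {n m : ℕ} {C : Set (Euc n)} {U : Set (Euc m)}
    {f : Euc n → Euc m → Euc n} {K : Euc n → Euc m} {π : TimePartition} {z : Euc n}
    {x : ℝ → Euc n} {u : ℝ → Euc m} {T : ℝ≥0∞} (h : IsSamplingSol C U f K π z x u T)
    (hCl : IsClosed C) (hne : C.Nonempty) {t : ℝ} (ht : x t ∉ C) :
    ENNReal.ofReal t < T := by
  by_contra hcon
  have hle : T ≤ ENNReal.ofReal t := not_lt.1 hcon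
  have htop : T ≠ ⊤ := ne_top_of_le_ne_top ENNReal.ofReal_ne_top hle
  have he := h.exit T.toReal ENNReal.toReal_nonneg (ENNReal.ofReal_toReal htop).symm
  have hpos : 0 < T.toReal := ENNReal.toReal_pos h.pos.ne' htop
  have hlt : T.toReal ≤ t := by
    by_contra hc
    have h1 := (ENNReal.ofReal_lt_ofReal_iff hpos).2 (not_le.1 hc)
    rw [ENNReal.ofReal_toReal htop] at h1
    exact absurd hle (not_le.2 h1)
  apply ht
  rw [he.2 t hlt, hCl.mem_iff_infDist_zero hne]
  exact he.1

theorem sol_stay {n m : ℕ} {C : Set (Euc n)} {U : Set (Euc m)}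
    {f : Euc n → Euc m → Euc n} {K : Euc n → Euc m} {π : TimePartition} {z : Euc n}
    {x : ℝ → Euc n} {u : ℝ → Euc m} {T : ℝ≥0∞} (h : IsSamplingSol C U f K π z x u T)
    {t : ℝ} (ht0 : 0 ≤ t) (ht : x t ∈ C) :
    x t ∈ closure Cᶜ ∧ ∀ s, t ≤ s → x s = x t := by
  have hle : T ≤ ENNReal.ofReal t := by
    by_contra hc
    exact h.outside t ht0 (not_le.1 hc) ht
  have htop : T ≠ ⊤ := ne_top_of_le_ne_top ENNReal.ofReal_ne_top hle
  have he := h.exit T.toReal ENNReal.toReal_nonneg (ENNReal.ofReal_toReal htop).symm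
  have hpos : 0 < T.toReal := ENNReal.toReal_pos h.pos.ne' htop
  have hlt : T.toReal ≤ t := by
    by_contra hc
    have h1 := (ENNReal.ofReal_lt_ofReal_iff hpos).2 (not_le.1 hc)
    rw [ENNReal.ofReal_toReal htop] at h1
    exact absurd hle (not_le.2 h1)
  refine ⟨?_, fun s hs => by rw [he.2 s (hlt.trans hs), he.2 t hlt]⟩
  rw [he.2 t hlt]
  have hcw : ContinuousWithinAt x (Set.Ioo 0 T.toReal) T.toReal :=
    (h.cont T.toReal hpos.le).mono (fun s hs => hs.1.le)
  refine hcw.mem_closure ?_ ?_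
  · rw [closure_Ioo hpos.ne]
    exact ⟨hpos.le, le_refl _⟩
  · intro s hs
    refine h.outside s hs.1.le ?_
    rw [← ENNReal.ofReal_toReal htop]
    exact (ENNReal.ofReal_lt_ofReal_iff hpos).2 hs.2

theorem sol_closure {n m : ℕ} {C : Set (Euc n)} {U : Set (Euc m)}
    {f : Euc n → Euc m → Euc n} {K : Euc n → Euc m} {π : TimePartition} {z : Euc n}
    {x : ℝ → Euc n} {u : ℝ → Euc m} {T : ℝ≥0∞} (h : IsSamplingSol C U f K π z x u T)
    {t : ℝ} (ht0 : 0 ≤ t) : x t ∈ closure Cᶜ := by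
  by_cases ht : x t ∈ C
  · exact (sol_stay h ht0 ht).1
  · exact subset_closure ht

theorem feedback_dec {n m : ℕ} {C : Set (Euc n)} {U : Set (Euc m)}
    {f : Euc n → Euc m → Euc n} {l : Euc n → Euc m → ℝ}
    {p0 : ℝ} {W : Euc n → ℝ} {γ : ℝ → ℝ} {N : ℝ → ℝ}
    {psel : Euc n → Euc n} {K : Euc n → Euc m}
    (hH0 : HypH0 C U f l) (hp0 : 0 ≤ p0)
    (hNdec : ∀ x, x ∉ C → ∀ p ∈ limitingGradients W x,
      HamN U f l (N (W x)) p0 x p < -γ (W x))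
    (hpsel : ∀ x, x ∉ C → psel x ∈ limitingGradients W x)
    (hK : IsWFeedback C U f l p0 W N psel K) {x : Euc n} (hx : x ∉ C) :
    ⟪psel x, f x (K x)⟫ ≤ -γ (W x) := by
  obtain ⟨hKU, hmin⟩ := hK x hx
  obtain ⟨w, ⟨v, hv, rfl⟩, hlt⟩ := exists_lt_of_csInf_lt
    (⟨_, Set.mem_image_of_mem _ hKU⟩) (hNdec x hx _ (hpsel x hx))
  have h1 := hmin v hv
  have h2 : 0 ≤ p0 * l x (K x) := mul_nonneg hp0 (hH0.2.2.2.1 x _ hKU.1)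
  simp only at hlt
  linarith

theorem C_nonempty {n m : ℕ} {C : Set (Euc n)} {U : Set (Euc m)}
    {f : Euc n → Euc m → Euc n} {l : Euc n → Euc m → ℝ}
    {p0 : ℝ} {W : Euc n → ℝ} {γ : ℝ → ℝ}
    {psel : Euc n → Euc n} {K : Euc n → Euc m}
    (hW : IsMRF C U f l p0 W γ)
    (hpsel : ∀ x, x ∉ C → psel x ∈ limitingGradients W x)
    (hdec : ∀ x, x ∉ C → ⟪psel x, f x (K x)⟫ ≤ -γ (W x)) : C.Nonempty := by
  by_contra hne
  rw [Set.not_nonempty_iff_eq_empty] at hne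
  subst hne
  obtain ⟨hWc, hW0, hsc, hpd, hprop, hγ, -⟩ := hW
  have hcomp := hprop (Set.Icc 0 (W 0)) isCompact_Icc (fun r hr => hr.1)
  simp only [Set.compl_empty, closure_univ, Set.univ_inter] at hcomp hWc hW0
  have hpos : ∀ y, 0 < W y := fun y => hpd.1 y (Set.notMem_empty y)
  obtain ⟨a, ha, hmin⟩ := hcomp.exists_isMinOn ⟨0, (hpos 0).le, le_refl _⟩
    (hWc.mono (Set.subset_univ _))
  have hglob : ∀ y, W a ≤ W y := by
    intro y
    by_cases hy : W y ≤ W 0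
    · exact hmin ⟨(hpos y).le, hy⟩
    · exact ha.2.trans (not_le.1 hy).le
  obtain ⟨ρ, hρ, hS⟩ := hsc (closedBall a 1) (isCompact_closedBall a 1) (by simp)
  have ha0 : a ∉ (∅ : Set (Euc n)) := Set.notMem_empty a
  have hp := hpsel a ha0
  have hd := hdec a ha0
  set p := psel a with hpdef
  have hp0 : p = 0 := by
    by_contra hpne
    have hnp : 0 < ‖p‖ := norm_pos_iff.2 hpne
    set s : ℝ := min (1 / (2 * ‖p‖)) (1 / (4 * ρ)) with hs
    have hs0 : 0 < s := by positivity
    have hs1 : s * ‖p‖ ≤ 1 / 2 := by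
      calc s * ‖p‖ ≤ 1 / (2 * ‖p‖) * ‖p‖ := by gcongr; exact min_le_left _ _
        _ = 1 / 2 := by field_simp
    have hs2 : s * ρ ≤ 1 / 4 := by
      calc s * ρ ≤ 1 / (4 * ρ) * ρ := by gcongr; exact min_le_right _ _
        _ = 1 / 4 := by field_simp
    have hnorm : ‖a - s • p - a‖ = s * ‖p‖ := by
      rw [sub_sub_cancel_left, norm_neg, norm_smul, Real.norm_eq_abs, abs_of_pos hs0]
    have h := semiconc_lim (C := (∅ : Set (Euc n))) (y := a - s • p) hρ isClosed_empty (by simpa using hWc)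
      (by simp) hS (ball_subset_closedBall) (by rw [mem_ball, dist_eq_norm, hnorm]; linarith) hp
    have h1 := hglob (a - s • p)
    rw [hnorm, sub_sub_cancel_left, inner_neg_right, inner_smul_right,
      real_inner_self_eq_norm_sq] at h
    have h2 : 0 < s * ‖p‖ ^ 2 := by positivity
    have h3 : 2 * ρ * (s * ‖p‖) ^ 2 = 2 * (s * ρ) * (s * ‖p‖ ^ 2) := by ring
    have h4 : 2 * (s * ρ) * (s * ‖p‖ ^ 2) ≤ 2 * (1/4) * (s * ‖p‖ ^ 2) := by gcongr
    linarith
  rw [hp0, inner_zero_left] at hd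
  have := hγ.2.2 _ (hpos a)
  linarith

end Helpers2

/-- Proposition 3.6 (invariance): sampling trajectories with small enough sampling
time enter and remain in the sublevel set `W⁻¹([0, μ̂])`. -/
theorem sampling_trajectories_enter_and_remain_in_sublevel_set
    {n m : ℕ} (C : Set (Euc n)) (U : Set (Euc m))
    (f : Euc n → Euc m → Euc n) (l : Euc n → Euc m → ℝ)
    (p0 : ℝ) (W : Euc n → ℝ) (γ : ℝ → ℝ) (N : ℝ → ℝ)
    (psel : Euc n → Euc n) (K : Euc n → Euc m)
    (hH0 : HypH0 C U f l) (hp0 : 0 ≤ p0) (hW : IsMRF C U f l p0 W γ)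
    (hN : ContinuousOn N (Set.Ioi 0)) (hNpos : ∀ r, 0 < r → 0 < N r)
    (hNdec : ∀ x, x ∉ C → ∀ p ∈ limitingGradients W x,
      HamN U f l (N (W x)) p0 x p < -γ (W x))
    (hpsel : ∀ x, x ∉ C → psel x ∈ limitingGradients W x)
    (hK : IsWFeedback C U f l p0 W N psel K) :
    ∀ μ σ : ℝ, 0 < μ → μ < σ → ∃ δ > (0:ℝ),
      ∀ π : TimePartition, (∀ j, π.t (j+1) - π.t j ≤ δ) →
      ∀ z, z ∉ C → μ < W z → W z ≤ σ →
      ∀ x u T, IsSamplingSol C U f K π z x u T →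
        (∃ t, 0 ≤ t ∧ W (x t) ≤ μ / 4) ∧
        ∀ t, sInf {s : ℝ | 0 ≤ s ∧ W (x s) ≤ μ / 4} ≤ t →
          0 ≤ W (x t) ∧ W (x t) ≤ μ := by
  intro μ σ hμ hμσ
  have hdec : ∀ x, x ∉ C → ⟪psel x, f x (K x)⟫ ≤ -γ (W x) :=
    fun x hx => feedback_dec hH0 hp0 hNdec hpsel hK hx
  have hne : C.Nonempty := C_nonempty hW hpsel hdec
  obtain ⟨hCl, -, -, -, huc, hbd⟩ := hH0
  obtain ⟨hWc, hW0, hsc, hpd, hprop, hγ, -⟩ := hW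
  have hfr : ∀ y, y ∈ closure Cᶜ → y ∈ C → W y = 0 := by
    intro y h1 h2
    apply hpd.2
    rw [frontier_eq_closure_inter_closure]
    exact ⟨subset_closure h2, h1⟩
  -- the compact band
  set S0 := closure Cᶜ ∩ W ⁻¹' Set.Icc (μ / 4) σ with hS0def
  have hS0c : IsCompact S0 := hprop _ isCompact_Icc
    (fun r hr => le_trans (by positivity) hr.1)
  have hS0C : S0 ⊆ Cᶜ := by
    intro y hy hyC
    have h1 := hfr y hy.1 hyC
    have h2 : μ / 4 ≤ W y := hy.2.1
    linarith
  obtain ⟨η, hη, hSC⟩ := hS0c.exists_cthickening_subset_open hCl.isOpen_compl hS0C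
  set S := cthickening η S0 with hSdef
  have hSc : IsCompact S := hS0c.cthickening
  have hballS : ∀ y ∈ S0, closedBall y η ⊆ S := fun y hy => closedBall_subset_cthickening hy η
  set D := closure Cᶜ ∩ W ⁻¹' Set.Icc 0 σ with hDdef
  have hDc : IsCompact D := hprop _ isCompact_Icc (fun r hr => hr.1)
  obtain ⟨R, hR, hRb⟩ : ∃ R : ℝ, 0 < R ∧ ∀ y ∈ S ∪ D, dC C y ≤ R := by
    obtain ⟨R, hR⟩ := (hSc.union hDc).bddAbove_image
      (f := fun y => dC C y) (continuous_infDist_pt C).continuousOn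
    exact ⟨max R 1, by positivity, fun y hy =>
      (hR (Set.mem_image_of_mem _ hy)).trans (le_max_left _ _)⟩
  obtain ⟨M, hM, hMb⟩ := hbd R hR
  obtain ⟨ρ, hρ, hS⟩ := hsc S hSc hSC
  -- bound on the selection
  obtain ⟨L, hL, hLb⟩ : ∃ L : ℝ, 0 ≤ L ∧ ∀ y ∈ S0, ‖psel y‖ ≤ L := by
    refine ⟨(σ + 2 * ρ * (η / 2) ^ 2) / (η / 2), by have : 0 < σ := hμ.trans hμσ
                                                    positivity, ?_⟩
    intro y hy
    rw [le_div_iff₀ (by positivity)]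
    set p := psel y with hp
    rcases eq_or_ne p 0 with h0 | h0
    · rw [h0, norm_zero, zero_mul]
      have : 0 < σ := hμ.trans hμσ
      positivity
    · have hnp : 0 < ‖p‖ := norm_pos_iff.2 h0
      set w := y - ((η / 2) / ‖p‖) • p with hw
      have hwy : w - y = -(((η / 2) / ‖p‖) • p) := by rw [hw]; abel
      have hnw : ‖w - y‖ = η / 2 := by
        rw [hwy, norm_neg, norm_smul, Real.norm_eq_abs, abs_of_pos (by positivity)]
        field_simp
      have hwb : w ∈ ball y η := by
        rw [mem_ball, dist_eq_norm, hnw]; linarith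
      have h := semiconc_lim hρ hCl hWc hSC hS
        (ball_subset_closedBall.trans (hballS y hy)) hwb (hpsel y (hS0C hy))
      have hWw : 0 < W w := hpd.1 w (hSC (hballS y hy (ball_subset_closedBall hwb)))
      have hin : ⟪psel y, w - y⟫ = -(‖p‖ * (η / 2)) := by
        rw [← hp, hwy, inner_neg_right, inner_smul_right, real_inner_self_eq_norm_sq]
        field_simp
      rw [hin, hnw] at h
      have h2 : W y ≤ σ := hy.2.2
      linarith
  set c := γ (μ / 4) with hcdef
  have hμ4 : 0 < μ / 4 := by positivity
  have hc : 0 < c := hγ.2.2 _ hμ4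
  obtain ⟨ω, hω, hωb⟩ : ∃ ω : ℝ, 0 < ω ∧ ∀ a ∈ S, ∀ b ∈ S, ∀ v ∈ U, dist a b < ω →
      ‖f a v - f b v‖ < c / (4 * (L + 1)) := by
    have h1 := (huc S hSc hSC).1
    rw [Metric.uniformContinuousOn_iff] at h1
    obtain ⟨ω, hω, h2⟩ := h1 (c / (4 * (L + 1))) (by positivity)
    refine ⟨ω, hω, fun a ha b hb v hv hab => ?_⟩
    have h3 := h2 (a, v) ⟨ha, hv⟩ (b, v) ⟨hb, hv⟩ (by simpa [Prod.dist_eq, hω] using hab)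
    rwa [dist_eq_norm] at h3
  obtain ⟨η₂, hη₂, hWu⟩ : ∃ η₂ : ℝ, 0 < η₂ ∧ ∀ a ∈ D, ∀ b ∈ D, dist a b < η₂ →
      dist (W a) (W b) < μ / 4 := by
    have h1 := hDc.uniformContinuousOn_of_continuous (hWc.mono Set.inter_subset_left)
    rw [Metric.uniformContinuousOn_iff] at h1
    obtain ⟨e, he, h2⟩ := h1 (μ / 4) hμ4
    exact ⟨e, he, fun a ha b hb => h2 a ha b hb⟩
  obtain ⟨δ, hδ, hδ1, hδ2, hδ3, hδ4⟩ : ∃ δ : ℝ, 0 < δ ∧ M * δ < η ∧ M * δ < ω ∧ M * δ < η₂ ∧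
      2 * ρ * M ^ 2 * δ ≤ c / 4 := by
    set q := min η (min ω η₂) with hq
    have hq0 : 0 < q := by positivity
    refine ⟨min (q / (2 * M)) (c / (8 * ρ * M ^ 2)), by positivity, ?_⟩
    have h1 : M * min (q / (2 * M)) (c / (8 * ρ * M ^ 2)) < q := by
      calc _ ≤ M * (q / (2 * M)) := by gcongr; exact min_le_left _ _
        _ = q / 2 := by field_simp
        _ < q := by linarith
    refine ⟨h1.trans_le (min_le_left _ _),
      h1.trans_le ((min_le_right _ _).trans (min_le_left _ _)),
      h1.trans_le ((min_le_right _ _).trans (min_le_right _ _)), ?_⟩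
    calc _ ≤ 2 * ρ * M ^ 2 * (c / (8 * ρ * M ^ 2)) := by gcongr; exact min_le_right _ _
      _ = c / 4 := by field_simp; norm_num
  refine ⟨δ, hδ, ?_⟩
  intro π hπ z hz hzμ hzσ x u T h
  have hcl : ∀ t, 0 ≤ t → x t ∈ closure Cᶜ := fun t ht => sol_closure h ht
  have hWx0 : ∀ t, 0 ≤ t → 0 ≤ W (x t) := fun t ht => hW0 _ (hcl t ht)
  have hWx : ContinuousOn (fun t => W (x t)) (Set.Ici 0) :=
    hWc.comp h.cont (fun t ht => hcl t ht)
  have hπ0 := partition_nonneg π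
  have hzero : ∀ t, 0 ≤ t → x t ∈ C → ∀ s, t ≤ s → W (x s) = 0 := by
    intro t ht hxt s hs
    have h1 := sol_stay h ht hxt
    rw [h1.2 s hs]
    exact hfr _ h1.1 hxt
  -- one step inside the band
  have hstep : ∀ j, x (π.t j) ∈ S0 → ∀ t, π.t j ≤ t → t ≤ π.t (j+1) →
      W (x t) ≤ W (x (π.t j)) - c / 2 * (t - π.t j) := by
    intro j hj
    have hKU : K (x (π.t j)) ∈ U := (hK _ (hS0C hj)).1.1
    have hcontd : ContinuousOn (fun t => dist (x t) (x (π.t j))) (Set.Ici 0) :=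
      fun t ht => (h.cont t ht).dist continuousWithinAt_const
    have hnear : ∀ t, π.t j ≤ t → t ≤ π.t (j+1) → dist (x t) (x (π.t j)) < η := by
      intro t h1 h2
      by_contra hcon
      obtain ⟨r, hr1, hr2, hr3, hr4⟩ := first_hit (v := η) h1
        (hcontd.mono (fun s hs => (hπ0 j).trans hs.1)) (by simpa using hη) (not_lt.1 hcon)
      have hinS : ∀ s, π.t j ≤ s → s < r → x s ∈ S := fun s hs1 hs2 =>
        hballS _ hj (mem_closedBall.2 (hr4 s hs1 hs2).le)
      have hn := sol_norm h (j := j) (M := M) le_rfl hr1 (hr2.trans h2)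
        (fun s hs1 hs2 => sol_lt h hCl hne (hSC (hinS s hs1.le hs2)))
        (fun s hs1 hs2 => (hMb _ _ (hRb _ (Or.inl (hinS s hs1.le hs2)))
          (hSC (hinS s hs1.le hs2)) hKU).1)
      rw [← dist_eq_norm, hr3] at hn
      have h3 : M * (r - π.t j) ≤ M * δ := by
        have := hπ j
        gcongr
        linarith
      linarith
    intro t h1 h2
    rcases h1.eq_or_lt with h1 | h1
    · rw [← h1]; simp
    have hinS : ∀ s, π.t j ≤ s → s ≤ t → x s ∈ S := fun s hs1 hs2 =>
      hballS _ hj (mem_closedBall.2 (hnear s hs1 (hs2.trans h2)).le)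
    have hT : ∀ s, π.t j ≤ s → s ≤ t → ENNReal.ofReal s < T := fun s hs1 hs2 =>
      sol_lt h hCl hne (hSC (hinS s hs1 hs2))
    have hfM : ∀ s, π.t j ≤ s → s ≤ t → ‖f (x s) (K (x (π.t j)))‖ ≤ M := fun s hs1 hs2 =>
      (hMb _ _ (hRb _ (Or.inl (hinS s hs1 hs2))) (hSC (hinS s hs1 hs2)) hKU).1
    have hn : ∀ s, π.t j < s → s ≤ t → ‖x s - x (π.t j)‖ ≤ M * (s - π.t j) := by
      intro s hs1 hs2
      exact sol_norm h (j := j) (M := M) le_rfl hs1 (hs2.trans h2)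
        (fun r hr1 hr2 => hT r hr1.le (hr2.le.trans hs2))
        (fun r hr1 hr2 => hfM r hr1.le (hr2.le.trans hs2))
    have htδ : t - π.t j ≤ δ := by linarith [hπ j]
    have htp : 0 < t - π.t j := by linarith
    obtain ⟨s, hs1, hs2, hs3⟩ := sol_mvt h (j := j) le_rfl h1 h2
      (fun r hr1 hr2 => hT r hr1.le hr2.le) (psel (x (π.t j)))
    have hsd : dist (x s) (x (π.t j)) < ω := by
      rw [dist_eq_norm]
      refine (hn s hs1 hs2.le).trans_lt (lt_of_le_of_lt ?_ hδ2)
      gcongr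
      linarith
    have hfd := hωb _ (hinS s hs1.le hs2.le) _ (hinS _ le_rfl h1.le) _ hKU hsd
    have hd := hdec _ (hS0C hj)
    have hγc : c ≤ γ (W (x (π.t j))) :=
      hγ.2.1.monotoneOn hμ4 (hμ4.trans_le hj.2.1) hj.2.1
    have hin : ⟪psel (x (π.t j)), f (x s) (K (x (π.t j)))⟫ ≤ - c + c / 4 := by
      have e : f (x s) (K (x (π.t j))) = f (x (π.t j)) (K (x (π.t j)))
          + (f (x s) (K (x (π.t j))) - f (x (π.t j)) (K (x (π.t j)))) := by abel
      rw [e, inner_add_right]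
      have h3 := (real_inner_le_norm (psel (x (π.t j)))
        (f (x s) (K (x (π.t j))) - f (x (π.t j)) (K (x (π.t j))))).trans
        (mul_le_mul (hLb _ hj) hfd.le (norm_nonneg _) hL)
      have h4 : L * (c / (4 * (L + 1))) ≤ c / 4 := by
        calc L * (c / (4 * (L + 1))) ≤ (L + 1) * (c / (4 * (L + 1))) := by gcongr; linarith
          _ = c / 4 := by field_simp
      linarith
    have hsemi := semiconc_lim hρ hCl hWc hSC hS
      (ball_subset_closedBall.trans (hballS _ hj)) (mem_ball.2 (hnear t h1.le h2))
      (hpsel _ (hS0C hj))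
    rw [hs3] at hsemi
    have h5 := mul_le_mul_of_nonneg_left hin htp.le
    have h6 : 2 * ρ * ‖x t - x (π.t j)‖ ^ 2 ≤ (t - π.t j) * (c / 4) := by
      calc 2 * ρ * ‖x t - x (π.t j)‖ ^ 2 ≤ 2 * ρ * (M * (t - π.t j)) ^ 2 := by
            gcongr
            exact hn t h1 le_rfl
        _ = (t - π.t j) * (2 * ρ * M ^ 2 * (t - π.t j)) := by ring
        _ ≤ (t - π.t j) * (2 * ρ * M ^ 2 * δ) := by gcongr
        _ ≤ (t - π.t j) * (c / 4) := by gcongr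
    linarith
  -- growth from a low level
  have hgrow : ∀ j s t, π.t j ≤ s → s ≤ t → t ≤ π.t (j+1) → W (x s) ≤ μ / 4 →
      W (x t) ≤ μ / 2 := by
    intro j s t hs hst ht hWs
    by_contra hcon
    have hs0 : 0 ≤ s := (hπ0 j).trans hs
    obtain ⟨r, hr1, hr2, hr3, hr4⟩ := first_hit (v := μ / 2) hst
      (hWx.mono (fun r hr => hs0.trans hr.1)) (by linarith) (not_le.1 hcon).le
    have hout : ∀ q, 0 ≤ q → q ≤ r → x q ∉ C := by
      intro q hq0 hqr hqC
      have := hzero q hq0 hqC r hqr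
      linarith
    have hD : ∀ q, s ≤ q → q ≤ r → x q ∈ D := by
      intro q hq1 hq2
      refine ⟨hcl q (hs0.trans hq1), hWx0 q (hs0.trans hq1), ?_⟩
      rcases hq2.eq_or_lt with h1 | h1
      · rw [h1, hr3]; linarith
      · have := hr4 q hq1 h1
        linarith
    have hKU : K (x (π.t j)) ∈ U := (hK _ (hout _ (hπ0 j) (by linarith))).1.1
    have hn := sol_norm h (j := j) (M := M) hs hr1 (hr2.trans ht)
      (fun q hq1 hq2 => sol_lt h hCl hne (hout q (hs0.trans hq1.le) hq2.le))
      (fun q hq1 hq2 => (hMb _ _ (hRb _ (Or.inr (hD q hq1.le hq2.le)))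
        (hout q (hs0.trans hq1.le) hq2.le) hKU).1)
    have h3 : M * (r - s) ≤ M * δ := by
      have := hπ j
      gcongr
      linarith
    have h4 := hWu _ (hD r hr1.le le_rfl) _ (hD s le_rfl hr1.le)
      (by rw [dist_eq_norm]; linarith)
    rw [Real.dist_eq] at h4
    have h5 := (le_abs_self _).trans_lt h4
    linarith
  have hex : ∃ t, 0 ≤ t ∧ W (x t) ≤ μ / 4 := by
    by_contra hcon
    push Not at hcon
    have hind : ∀ j, W (x (π.t j)) ≤ σ - c / 2 * π.t j := by
      intro j
      induction j with
      | zero => rw [π.zero, h.init]; linarith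
      | succ j ih =>
        have hm : x (π.t j) ∈ S0 := by
          refine ⟨hcl _ (hπ0 j), (hcon _ (hπ0 j)).le, ih.trans ?_⟩
          have := mul_nonneg (half_pos hc).le (hπ0 j)
          linarith
        have := hstep j hm (π.t (j+1)) (π.mono (Nat.lt_succ_self j)).le le_rfl
        linarith
    obtain ⟨j, hj⟩ := (π.unbounded.eventually_gt_atTop (σ / (c / 2))).exists
    rw [div_lt_iff₀ (by positivity)] at hj
    have h1 := hind j
    have h2 := hWx0 _ (hπ0 j)
    linarith
  refine ⟨hex, ?_⟩
  set A := {s : ℝ | 0 ≤ s ∧ W (x s) ≤ μ / 4} with hA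
  have hAcl : IsClosed A :=
    hWx.preimage_isClosed_of_isClosed isClosed_Ici isClosed_Iic
  have hAm : sInf A ∈ A := hAcl.csInf_mem hex ⟨0, fun s hs => hs.1⟩
  obtain ⟨hb0, hbW⟩ := hAm
  set b := sInf A
  intro t hbt
  refine ⟨hWx0 t (hb0.trans hbt), ?_⟩
  obtain ⟨j, hj1, hj2⟩ := partition_locate π hb0
  have hlow : ∀ i, W (x (π.t i)) ≤ μ / 2 → ∀ t, π.t i ≤ t → t ≤ π.t (i+1) →
      W (x t) ≤ μ / 2 := by
    intro i hi t h1 h2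
    by_cases h3 : W (x (π.t i)) ≤ μ / 4
    · exact hgrow i _ t le_rfl h1 h2 h3
    · have h4 := hstep i ⟨hcl _ (hπ0 i), (not_le.1 h3).le, by linarith⟩ t h1 h2
      have := mul_nonneg (half_pos hc).le (sub_nonneg.2 h1)
      linarith
  have hlater : ∀ k, W (x (π.t (j + 1 + k))) ≤ μ / 2 := by
    intro k
    induction k with
    | zero => exact hgrow j b _ hj1 hj2.le le_rfl hbW
    | succ k ih => exact hlow _ ih _ (π.mono (Nat.lt_succ_self _)).le le_rfl
  suffices W (x t) ≤ μ / 2 by linarith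
  rcases le_or_gt t (π.t (j+1)) with h1 | h1
  · exact hgrow j b t hj1 hbt h1 hbW
  · obtain ⟨i, hi1, hi2⟩ := partition_locate π (hb0.trans hbt)
    have h3 : j + 1 < i + 1 := π.mono.lt_iff_lt.1 (h1.trans hi2)
    obtain ⟨k, rfl⟩ := Nat.exists_eq_add_of_le (Nat.lt_succ_iff.1 h3)
    exact hlow _ (hlater k) t hi1 hi2.le
end

section
/- Assume hypothesis (H0). Let W : closure(ℝⁿ ∖ C) → [0,∞) be a continuous function which is locally semiconcave, positive definite and proper on ℝⁿ ∖ C, and let p₀ ≥ 0. Then W is a p₀-Minimum Restraint Function if and only if for every continuous function W₁ : closure(ℝⁿ ∖ C) → [0,∞) which is positive definite and proper on ℝⁿ ∖ C there exists a continuous strictly increasing function γ̃ : (0,∞) → (0,∞) such that H(x,p₀,p) ≤ −γ̃(W₁(x)) for every x ∈ ℝⁿ ∖ C and every p ∈ D*W(x). -/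
open Filter Topology Metric MeasureTheory Bornology
open scoped RealInnerProductSpace ENNReal NNReal

theorem aux_lower_bound {n : ℕ} (C : Set (Euc n)) (W W1 : Euc n → ℝ)
    (hWc : ContinuousOn W (closure Cᶜ)) (hWnn : ∀ x ∈ closure Cᶜ, 0 ≤ W x)
    (hpd : PosDefOn C W) (hpr : ProperOn C W)
    (hW1c : ContinuousOn W1 (closure Cᶜ)) (hpd1 : PosDefOn C W1) (r : ℝ) (hr : 0 < r) :
    ∃ c, 0 < c ∧ ∀ x, x ∉ C → r ≤ W1 x → c ≤ W x := by
  have hK : IsCompact ((closure Cᶜ ∩ W ⁻¹' (Set.Icc 0 1)) ∩ (closure Cᶜ ∩ W1 ⁻¹' (Set.Ici r))) :=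
    (hpr _ isCompact_Icc (fun y hy => hy.1)).inter_right
      (hW1c.preimage_isClosed_of_isClosed isClosed_closure isClosed_Ici)
  rcases Set.eq_empty_or_nonempty
    ((closure Cᶜ ∩ W ⁻¹' (Set.Icc 0 1)) ∩ (closure Cᶜ ∩ W1 ⁻¹' (Set.Ici r))) with he | hne
  · refine ⟨1, one_pos, fun x hx hrx => ?_⟩
    by_contra! h
    have hxc : x ∈ closure Cᶜ := subset_closure hx
    have : x ∈ ((closure Cᶜ ∩ W ⁻¹' (Set.Icc 0 1)) ∩ (closure Cᶜ ∩ W1 ⁻¹' (Set.Ici r))) :=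
      ⟨⟨hxc, hWnn x hxc, h.le⟩, hxc, hrx⟩
    rw [he] at this
    exact this
  · obtain ⟨y, ⟨⟨hyc, -⟩, -, hyr⟩, hmin⟩ :=
      hK.exists_isMinOn hne (hWc.mono (fun z hz => hz.1.1))
    have hyC : y ∉ C := by
      intro hy
      have hf : y ∈ frontier C := by
        rw [frontier_eq_closure_inter_closure]
        exact ⟨subset_closure hy, hyc⟩
      have h0 := hpd1.2 y hf
      have h1 : r ≤ W1 y := hyr
      linarith
    refine ⟨min 1 (W y), lt_min one_pos (hpd.1 y hyC), fun x hx hrx => ?_⟩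
    have hxc : x ∈ closure Cᶜ := subset_closure hx
    rcases le_total (W x) 1 with h | h
    · exact (min_le_right _ _).trans (hmin ⟨⟨hxc, hWnn x hxc, h⟩, hxc, hrx⟩)
    · exact (min_le_left _ _).trans h

/-- Proposition 4.1: equivalent formulation of the `p₀`-MRF decrease condition with
an arbitrary positive definite proper function `W₁` in place of `W`. -/
theorem mrf_decrease_condition_equivalent_reformulation
    {n m : ℕ} (C : Set (Euc n)) (U : Set (Euc m))
    (f : Euc n → Euc m → Euc n) (l : Euc n → Euc m → ℝ)
    (p0 : ℝ) (W : Euc n → ℝ)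
    (hH0 : HypH0 C U f l) (hp0 : 0 ≤ p0)
    (hWc : ContinuousOn W (closure Cᶜ)) (hWnn : ∀ x ∈ closure Cᶜ, 0 ≤ W x)
    (hsc : LocSemiconcaveOn C W) (hpd : PosDefOn C W) (hpr : ProperOn C W) :
    (∃ γ : ℝ → ℝ, RateFun γ ∧
      ∀ x, x ∉ C → ∀ p ∈ limitingGradients W x, Ham U f l p0 x p ≤ -γ (W x))
    ↔
    (∀ W1 : Euc n → ℝ, ContinuousOn W1 (closure Cᶜ) →
      (∀ x ∈ closure Cᶜ, 0 ≤ W1 x) → PosDefOn C W1 → ProperOn C W1 →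
      ∃ γt : ℝ → ℝ, RateFun γt ∧
        ∀ x, x ∉ C → ∀ p ∈ limitingGradients W x, Ham U f l p0 x p ≤ -γt (W1 x)) := by
  constructor
  · rintro ⟨γ, ⟨-, hγm, hγp⟩, hγ⟩ W1 hW1c hW1nn hpd1 hpr1
    rcases isEmpty_or_nonempty {x : Euc n // x ∉ C} with hE | hN
    · refine ⟨fun r => r, ⟨continuousOn_id, fun a _ b _ h => h, fun r hr => hr⟩, fun x hx => ?_⟩
      exact (hE.false ⟨x, hx⟩).elim
    have hγW : ∀ x : {x : Euc n // x ∉ C}, 0 < γ (W x) := fun x => hγp _ (hpd.1 x x.2)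
    let F : ℝ → {x : Euc n // x ∉ C} → ℝ := fun r x => γ (W x) + max 0 (r - W1 x)
    have hbdd : ∀ r, BddBelow (Set.range (F r)) := fun r => ⟨0, by
      rintro _ ⟨x, rfl⟩
      exact add_nonneg (hγW x).le (le_max_left _ _)⟩
    let h : ℝ → ℝ := fun r => ⨅ x, F r x
    have hmono : Monotone h := fun a b hab =>
      ciInf_mono (hbdd a) fun x => by
        dsimp only [F]
        gcongr
    have hlip : ∀ a b, h a ≤ h b + |a - b| := by
      intro a b
      rw [← sub_le_iff_le_add]
      refine le_ciInf fun x => ?_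
      rw [sub_le_iff_le_add]
      refine (ciInf_le (hbdd a) x).trans ?_
      dsimp only [F]
      have h1 := le_abs_self (a - b)
      have h2 := abs_nonneg (a - b)
      have : max 0 (a - W1 x) ≤ max 0 (b - W1 x) + |a - b| := by
        refine max_le (add_nonneg (le_max_left _ _) h2) ?_
        have := le_max_right 0 (b - W1 x)
        linarith
      linarith
    have hcont : Continuous h := by
      refine (LipschitzWith.of_dist_le_mul (K := 1) fun a b => ?_).continuous
      rw [Real.dist_eq, Real.dist_eq, NNReal.coe_one, one_mul, abs_le]
      have h1 := hlip a b
      have h2 := hlip b a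
      rw [abs_sub_comm b a] at h2
      constructor <;> linarith
    have hpos : ∀ r, 0 < r → 0 < h r := by
      intro r hr
      obtain ⟨c, hc, hcW⟩ := aux_lower_bound C W W1 hWc hWnn hpd hpr hW1c hpd1 (r / 2) (half_pos hr)
      have : min (γ c) (r / 2) ≤ h r := by
        refine le_ciInf fun x => ?_
        dsimp only [F]
        rcases le_total (r / 2) (W1 x) with hx | hx
        · have h1 : γ c ≤ γ (W x) :=
            hγm.monotoneOn hc (hpd.1 x x.2) (hcW x x.2 hx)
          have h2 := le_max_left 0 (r - W1 x)
          have h3 := min_le_left (γ c) (r / 2)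
          linarith
        · have h1 := hγW x
          have h2 := le_max_right 0 (r - W1 x)
          have h3 := min_le_right (γ c) (r / 2)
          linarith
      exact (lt_min (hγp c hc) (half_pos hr)).trans_le this
    refine ⟨fun r => h r * (r / (1 + r)), ⟨?_, ?_, ?_⟩, ?_⟩
    · refine hcont.continuousOn.mul (continuousOn_id.div (by fun_prop) fun r hr => ?_)
      have : (0:ℝ) < r := hr
      positivity
    · intro a ha b hb hab
      have ha' : (0:ℝ) < a := ha
      have hb' : (0:ℝ) < b := hb
      have h1 : a / (1 + a) < b / (1 + b) := by
        rw [div_lt_div_iff₀ (by positivity) (by positivity)]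
        nlinarith
      exact mul_lt_mul' (hmono hab.le) h1 (by positivity) (hpos b hb')
    · intro r hr
      exact mul_pos (hpos r hr) (by positivity)
    · intro x hx p hp
      refine (hγ x hx p hp).trans (neg_le_neg ?_)
      have hw : 0 < W1 x := hpd1.1 x hx
      have h1 : h (W1 x) ≤ γ (W x) := by
        refine (ciInf_le (hbdd (W1 x)) ⟨x, hx⟩).trans ?_
        simp [F]
      have h2 : W1 x / (1 + W1 x) ≤ 1 := by
        rw [div_le_one (by positivity)]
        linarith
      exact (mul_le_of_le_one_right (hpos _ hw).le h2).trans h1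
  · intro h
    exact h W hWc hWnn hpd hpr
end

section
/- Assume hypothesis (H0). Let W : closure(ℝⁿ ∖ C) → [0,∞) be a continuous function which is locally Lipschitz, positive definite and proper on ℝⁿ ∖ C, let p₀ ≥ 0 and let Ω ⊆ ℝⁿ ∖ C. Then the following are equivalent: (i) there exists a continuous strictly increasing γ : (0,∞) → (0,∞) such that H(x,p₀,p) ≤ −γ(W(x)) for every x ∈ Ω and every p ∈ ∂_P W(x); (ii) for every continuous function W₁ : closure(ℝⁿ ∖ C) → [0,∞) which is positive definite and proper on ℝⁿ ∖ C there exists a continuous strictly increasing γ̃ : (0,∞) → (0,∞) such that H(x,p₀,p) ≤ −γ̃(W₁(x)) for every x ∈ Ω and every p ∈ ∂_P W(x). -/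
open Filter Topology Metric MeasureTheory Bornology
open scoped RealInnerProductSpace ENNReal NNReal

theorem exists_rate {ι : Type*} [Nonempty ι] (a b : ι → ℝ) (ha : ∀ i, 0 < a i)
    (h : ∀ r, 0 < r → ∃ c, 0 < c ∧ ∀ i, r ≤ b i → c ≤ a i) (hb : ∀ i, 0 < b i) :
    ∃ γ : ℝ → ℝ, RateFun γ ∧ ∀ i, γ (b i) ≤ a i := by
  set ψ : ℝ → ℝ := fun r => ⨅ i, (a i + max (r - b i) 0) with hψ
  have hnn : ∀ r i, 0 ≤ a i + max (r - b i) 0 := fun r i =>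
    add_nonneg (ha i).le (le_max_right _ _)
  have hbd : ∀ r, BddBelow (Set.range fun i => a i + max (r - b i) 0) := fun r =>
    ⟨0, by rintro _ ⟨i, rfl⟩; exact hnn r i⟩
  have hmono : Monotone ψ := by
    intro r s hrs
    refine ciInf_mono (hbd r) fun i => ?_
    have : max (r - b i) 0 ≤ max (s - b i) 0 := max_le_max (by linarith) le_rfl
    linarith
  have hlip : ∀ r s, ψ r ≤ ψ s + |r - s| := by
    intro r s
    rw [← sub_le_iff_le_add]
    refine le_ciInf fun i => ?_
    have h1 : ψ r ≤ a i + max (r - b i) 0 := ciInf_le (hbd r) i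
    have h2 : max (r - b i) 0 ≤ max (s - b i) 0 + |r - s| := by
      refine max_le ?_ ?_
      · have := le_max_left (s - b i) 0
        have := le_abs_self (r - s)
        linarith
      · have := le_max_right (s - b i) 0
        have := abs_nonneg (r - s)
        linarith
    linarith
  have hcont : Continuous ψ := by
    refine (LipschitzWith.of_le_add_mul 1 fun r s => ?_).continuous
    simpa [Real.dist_eq] using hlip r s
  have hpos : ∀ r, 0 < r → 0 < ψ r := by
    intro r hr
    obtain ⟨c, hc, hc'⟩ := h (r / 2) (by linarith)
    refine lt_of_lt_of_le (lt_min hc (half_pos hr)) (le_ciInf fun i => ?_)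
    rcases le_total (r / 2) (b i) with hi | hi
    · have := hc' i hi
      have := le_max_right (r - b i) 0
      exact (min_le_left _ _).trans (by linarith)
    · have := le_max_left (r - b i) 0
      have := ha i
      exact (min_le_right _ _).trans (by linarith)
  have hfac : ∀ r : ℝ, 0 < r → r / (1 + r) < 1 := fun r hr => by
    rw [div_lt_one (by linarith)]; linarith
  refine ⟨fun r => ψ r * (r / (1 + r)), ⟨?_, ?_, ?_⟩, ?_⟩
  · refine hcont.continuousOn.mul (continuousOn_id.div (by fun_prop) ?_)
    intro r hr
    have : 0 < r := hr
    positivity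
  · intro r hr s hs hrs
    have hr' : 0 < r := hr
    have hs' : 0 < s := hs
    have h1 : r / (1 + r) < s / (1 + s) := by
      rw [div_lt_div_iff₀ (by linarith) (by linarith)]; nlinarith
    have h2 : ψ r ≤ ψ s := hmono hrs.le
    have h3 : 0 < r / (1 + r) := by positivity
    exact mul_lt_mul_of_le_of_lt_of_pos_of_nonneg h2 h1 (hpos r hr') (h3.trans h1).le
  · intro r hr
    have := hpos r hr
    positivity
  · intro i
    have h1 : ψ (b i) ≤ a i := by
      have : ψ (b i) ≤ a i + max (b i - b i) 0 := ciInf_le (hbd (b i)) i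
      simpa using this
    exact (mul_le_of_le_one_right (hpos _ (hb i)).le (hfac _ (hb i)).le).trans h1

/-- Proposition 4.2: for a locally Lipschitz `W`, the proximal decrease condition
with rate `γ(W(x))` on `Ω` is equivalent to the one with rate `γ̃(W₁(x))` for any
positive definite, proper `W₁`. -/
theorem lipschitz_decrease_condition_equivalent_reformulation
    {n m : ℕ} (C : Set (Euc n)) (U : Set (Euc m))
    (f : Euc n → Euc m → Euc n) (l : Euc n → Euc m → ℝ)
    (p0 : ℝ) (W : Euc n → ℝ) (Ω : Set (Euc n))
    (hH0 : HypH0 C U f l) (hp0 : 0 ≤ p0) (hΩ : Ω ⊆ Cᶜ)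
    (hWc : ContinuousOn W (closure Cᶜ)) (hWnn : ∀ x ∈ closure Cᶜ, 0 ≤ W x)
    (hlip : LocLipschitzOn Cᶜ W) (hpd : PosDefOn C W) (hpr : ProperOn C W) :
    (∃ γ : ℝ → ℝ, RateFun γ ∧
      ∀ x ∈ Ω, ∀ p ∈ proxSubdiff W x, Ham U f l p0 x p ≤ -γ (W x))
    ↔
    (∀ W1 : Euc n → ℝ, ContinuousOn W1 (closure Cᶜ) →
      (∀ x ∈ closure Cᶜ, 0 ≤ W1 x) → PosDefOn C W1 → ProperOn C W1 →
      ∃ γt : ℝ → ℝ, RateFun γt ∧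
        ∀ x ∈ Ω, ∀ p ∈ proxSubdiff W x, Ham U f l p0 x p ≤ -γt (W1 x)) := by
  constructor
  · rintro ⟨γ, ⟨hγc, hγm, hγp⟩, hγ⟩ W1 hc1 hnn1 hpd1 hpr1
    have hCcl : IsClosed C := hH0.1
    rcases isEmpty_or_nonempty {x : Euc n // x ∉ C} with he | he
    · refine ⟨fun r => r, ⟨continuousOn_id, fun _ _ _ _ h => h, fun _ h => h⟩, ?_⟩
      intro x hx
      exact (he.false ⟨x, hΩ hx⟩).elim
    · have key : ∀ r, 0 < r → ∃ c, 0 < c ∧ ∀ x : {x : Euc n // x ∉ C},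
          r ≤ W1 x → c ≤ γ (W x) := by
        intro r hr
        suffices H : ∃ c, 0 < c ∧ ∀ x, x ∉ C → r ≤ W1 x → c ≤ W x by
          obtain ⟨c, hc, hc'⟩ := H
          exact ⟨γ c, hγp c hc, fun x hx =>
            hγm.monotoneOn hc (hpd.1 x x.2) (hc' x x.2 hx)⟩
        have hK0 := hpr (Set.Icc 0 1) isCompact_Icc (fun _ h => h.1)
        have hcl : IsClosed (closure Cᶜ ∩ W1 ⁻¹' Set.Ici r) :=
          hc1.preimage_isClosed_of_isClosed isClosed_closure isClosed_Ici
        have hK := hK0.inter_right hcl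
        rcases Set.eq_empty_or_nonempty
          ((closure Cᶜ ∩ W ⁻¹' Set.Icc 0 1) ∩ (closure Cᶜ ∩ W1 ⁻¹' Set.Ici r)) with hE | hN
        · refine ⟨1, one_pos, fun x hx hrx => ?_⟩
          by_contra! hlt
          have hxc : x ∈ closure Cᶜ := subset_closure hx
          have : x ∈ (closure Cᶜ ∩ W ⁻¹' Set.Icc 0 1) ∩ (closure Cᶜ ∩ W1 ⁻¹' Set.Ici r) :=
            ⟨⟨hxc, hWnn x hxc, hlt.le⟩, hxc, hrx⟩
          rw [hE] at this
          exact this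
        · obtain ⟨z, hz, hmin⟩ := hK.exists_isMinOn hN
            (hWc.mono fun x hx => hx.1.1)
          have hzC : z ∉ C := by
            intro hzC
            have hzf : z ∈ frontier C := by
              rw [frontier_eq_closure_inter_closure]
              exact ⟨subset_closure hzC, hz.1.1⟩
            have h0 := hpd1.2 z hzf
            have h1 : r ≤ W1 z := hz.2.2
            linarith
          refine ⟨min (W z) 1, lt_min (hpd.1 z hzC) one_pos, fun x hx hrx => ?_⟩
          rcases le_total (W x) 1 with h1 | h1
          · have hxc : x ∈ closure Cᶜ := subset_closure hx
            exact (min_le_left _ _).trans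
              (hmin ⟨⟨hxc, hWnn x hxc, h1⟩, hxc, hrx⟩)
          · exact (min_le_right _ _).trans h1
      obtain ⟨γt, hγt, hle⟩ := exists_rate (ι := {x : Euc n // x ∉ C})
        (fun x => γ (W x)) (fun x => W1 x) (fun x => hγp _ (hpd.1 x x.2)) key
        (fun x => hpd1.1 x x.2)
      refine ⟨γt, hγt, fun x hx p hp => (hγ x hx p hp).trans ?_⟩
      exact neg_le_neg (hle ⟨x, hΩ hx⟩)
  · intro h
    exact h W hWc hWnn hpd hpr
end
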